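/- If G is a triangulated minimal S-imperfect graph, then θ_S(G) = α_S(G) + 1. -/

import Mathlib

open SimpleGraph

/-- A set `T` of vertices is *S-independent* in `G` if any two distinct vertices of `T`
are at distance at least 3 in `G` (equivalently, no two of them lie in a common star
subgraph of `G`): they are non-adjacent and have no common neighbor. -/
def SimpleGraph.SIndepSet {V : Type*} (G : SimpleGraph V) (T : Set V) : Prop :=
  ∀ u ∈ T, ∀ w ∈ T, u ≠ w → ¬ G.Adj u w ∧ ∀ x : V, ¬ (G.Adj u x ∧ G.Adj x w)

/-- `D` is a dominating set of `G`: every vertex is in `D` or adjacent to a vertex of `D`. -/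
def SimpleGraph.DominatingSet {V : Type*} (G : SimpleGraph V) (D : Finset V) : Prop :=
  ∀ v : V, v ∈ D ∨ ∃ d ∈ D, G.Adj d v

/-- `α_S(G)`: the maximum size of an S-independent set of vertices of `G`. -/
noncomputable def alphaS {V : Type*} (G : SimpleGraph V) : ℕ :=
  sSup {n | ∃ T : Finset V, G.SIndepSet ↑T ∧ T.card = n}

/-- `θ_S(G)`: the domination number of `G`, i.e. the minimum size of a dominating set
(equivalently, the minimum number of stars needed to cover all vertices of `G`). -/
noncomputable def thetaS {V : Type*} (G : SimpleGraph V) : ℕ :=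
  sInf {n | ∃ D : Finset V, G.DominatingSet D ∧ D.card = n}

/-- `G` is *S-perfect* if `α_S(H) = θ_S(H)` for every induced subgraph `H` of `G`
(induced on any subset of the vertices). -/
def SPerfect {V : Type*} (G : SimpleGraph V) : Prop :=
  ∀ s : Set V, alphaS (G.induce s) = thetaS (G.induce s)

/-- `G` is *minimal S-imperfect* if `α_S(G) ≠ θ_S(G)` and `G − v` is S-perfect
for every vertex `v` of `G`. -/
def MinSImperfect {V : Type*} (G : SimpleGraph V) : Prop :=
  alphaS G ≠ thetaS G ∧ ∀ v : V, SPerfect (G.induce {v}ᶜ)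

/-- `G` is *triangulated* (chordal): it has no induced cycle of length at least 4. -/
def Chordal {V : Type*} (G : SimpleGraph V) : Prop :=
  ∀ n : ℕ, 4 ≤ n → ∀ s : Set V, ¬ Nonempty (G.induce s ≃g SimpleGraph.cycleGraph n)

theorem bddAbove_card_sIndepSet {V : Type*} [Finite V] (G : SimpleGraph V) :
    BddAbove {n | ∃ T : Finset V, G.SIndepSet ↑T ∧ T.card = n} := by
  have := Fintype.ofFinite V
  refine ⟨Fintype.card V, ?_⟩
  rintro n ⟨T, -, rfl⟩
  exact T.card_le_univ

theorem SimpleGraph.SIndepSet.card_le_alphaS {V : Type*} [Finite V] {G : SimpleGraph V}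
    {T : Finset V} (hT : G.SIndepSet ↑T) : T.card ≤ alphaS G :=
  le_csSup (bddAbove_card_sIndepSet G) ⟨T, hT, rfl⟩

theorem exists_sIndepSet_card_eq_alphaS {V : Type*} [Finite V] (G : SimpleGraph V) :
    ∃ T : Finset V, G.SIndepSet ↑T ∧ T.card = alphaS G :=
  Nat.sSup_mem (s := {n | ∃ T : Finset V, G.SIndepSet ↑T ∧ T.card = n})
    ⟨0, ∅, by simp [SimpleGraph.SIndepSet], rfl⟩ (bddAbove_card_sIndepSet G)

theorem SimpleGraph.DominatingSet.thetaS_le_card {V : Type*} {G : SimpleGraph V}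
    {D : Finset V} (hD : G.DominatingSet D) : thetaS G ≤ D.card :=
  Nat.sInf_le ⟨D, hD, rfl⟩

theorem exists_dominatingSet_card_eq_thetaS {V : Type*} [Finite V] (G : SimpleGraph V) :
    ∃ D : Finset V, G.DominatingSet D ∧ D.card = thetaS G := by
  have := Fintype.ofFinite V
  exact Nat.sInf_mem (s := {n | ∃ D : Finset V, G.DominatingSet D ∧ D.card = n})
    ⟨_, Finset.univ, fun v => Or.inl (Finset.mem_univ v), rfl⟩

theorem alphaS_le_thetaS {V : Type*} [Finite V] (G : SimpleGraph V) :
    alphaS G ≤ thetaS G := by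
  obtain ⟨T, hT, hTc⟩ := exists_sIndepSet_card_eq_alphaS G
  obtain ⟨D, hD, hDc⟩ := exists_dominatingSet_card_eq_thetaS G
  rw [← hTc, ← hDc]
  have hcover (t : V) : ∃ d ∈ D, d = t ∨ G.Adj d t := by
    rcases hD t with h | ⟨d, hd, hdt⟩
    · exact ⟨t, h, Or.inl rfl⟩
    · exact ⟨d, hd, Or.inr hdt⟩
  choose f hfD hf using hcover
  refine Finset.card_le_card_of_injOn f (fun t _ => hfD t) fun t ht u hu htu => ?_
  by_contra hne
  obtain ⟨hna, hnx⟩ := hT t ht u hu hne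
  rcases hf t with h1 | h1 <;> rcases hf u with h2 | h2
  · exact hne (by rw [← h1, ← h2, htu])
  · exact hna (by rwa [← htu, h1] at h2)
  · exact hna (by rw [htu, h2] at h1; exact h1.symm)
  · exact hnx (f t) ⟨h1.symm, by rwa [htu]⟩

/-- Adding one vertex increases the domination number by at most one. -/
theorem thetaS_le_thetaS_add_one {V W : Type*} [Finite W] {G : SimpleGraph V}
    {H : SimpleGraph W} (φ : H ↪g G) {v : V} (hφ : ∀ w, w ≠ v → w ∈ Set.range φ) :
    thetaS G ≤ thetaS H + 1 := by
  classical
  obtain ⟨D, hD, hDc⟩ := exists_dominatingSet_card_eq_thetaS H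
  have hdom : G.DominatingSet (insert v (D.image φ)) := by
    intro w
    by_cases hw : w = v
    · exact Or.inl (by simp [hw])
    obtain ⟨x, rfl⟩ := hφ w hw
    rcases hD x with h | ⟨d, hd, hdx⟩
    · exact Or.inl (Finset.mem_insert_of_mem (Finset.mem_image_of_mem φ h))
    · exact Or.inr ⟨φ d, Finset.mem_insert_of_mem (Finset.mem_image_of_mem φ hd),
        φ.map_rel_iff.2 hdx⟩
  calc thetaS G ≤ _ := hdom.thetaS_le_card
    _ ≤ (D.image φ).card + 1 := Finset.card_insert_le _ _
    _ ≤ thetaS H + 1 := by rw [← hDc]; gcongr; exact Finset.card_image_le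

/-- Deleting a vertex whose neighbours are pairwise adjacent does not increase `alphaS`. -/
theorem alphaS_le_alphaS_of_isClique_neighborSet {V W : Type*} [Finite V]
    {G : SimpleGraph V} {H : SimpleGraph W} (φ : H ↪g G) {v : V}
    (hφ : ∀ w, w ≠ v → w ∈ Set.range φ) (hv : G.IsClique (G.neighborSet v)) :
    alphaS H ≤ alphaS G := by
  have := Finite.of_injective φ φ.injective
  obtain ⟨T, hT, hTc⟩ := exists_sIndepSet_card_eq_alphaS H
  have hind : G.SIndepSet ↑(T.map φ.toEmbedding) := by
    simp only [Finset.coe_map]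
    rintro _ ⟨a, ha, rfl⟩ _ ⟨b, hb, rfl⟩ hne
    obtain ⟨hna, hnx⟩ := hT a ha b hb fun h => hne (h ▸ rfl)
    have hna' : ¬ G.Adj (φ a) (φ b) := fun h => hna (φ.map_rel_iff.1 h)
    refine ⟨hna', fun x hx => ?_⟩
    by_cases hxv : x = v
    · subst hxv
      exact hna' (hv hx.1.symm hx.2 hne)
    · obtain ⟨y, rfl⟩ := hφ x hxv
      exact hnx y ⟨φ.map_rel_iff.1 hx.1, φ.map_rel_iff.1 hx.2⟩
  calc alphaS H = (T.map φ.toEmbedding).card := by rw [Finset.card_map, hTc]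
    _ ≤ alphaS G := hind.card_le_alphaS

theorem Chordal.isEmpty_cycleGraph_embedding {V : Type*} {G : SimpleGraph V}
    (hc : Chordal G) {n : ℕ} (hn : 4 ≤ n) : IsEmpty (SimpleGraph.cycleGraph n ↪g G) := by
  refine ⟨fun φ => hc n hn (Set.range φ) ⟨RelIso.symm ⟨Equiv.ofInjective φ φ.injective, ?_⟩⟩⟩
  intro a b
  exact φ.map_rel_iff

/-- If some path from `x` to `y` has its interior in `C`, then so does some induced path. -/
theorem exists_induced_path {V : Type*} (G : SimpleGraph V) {C : Set V} {x y : V} (hxy : x ≠ y)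
    (hy : y ∉ C)
    (hpath : ∃ (n : ℕ) (f : ℕ → V), f 0 = x ∧ f n = y ∧ (∀ i < n, G.Adj (f i) (f (i + 1))) ∧
      ∀ i, 0 < i → i < n → f i ∈ C) :
    ∃ (n : ℕ) (f : ℕ → V), f 0 = x ∧ f n = y ∧ (∀ i, 0 < i → i < n → f i ∈ C) ∧
      (∀ i j, i < j → j ≤ n → f i ≠ f j) ∧
      (∀ i j, i < j → j ≤ n → (G.Adj (f i) (f j) ↔ j = i + 1)) := by
  classical
  obtain ⟨f, h0, hn, hadj, hC⟩ := Nat.find_spec hpath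
  have hmin := fun m (hm : m < Nat.find hpath) => Nat.find_min hpath hm
  generalize Nat.find hpath = n at *
  have hne : ∀ i j, i < j → j ≤ n → f i ≠ f j := by
    intro i j hij hj hfe
    rcases Nat.lt_or_ge j n with hjn | hjn
    · refine hmin (n - (j - i)) (by omega)
        ⟨fun k => if k ≤ i then f k else f (k + (j - i)), ?_, ?_, ?_, ?_⟩
      · simpa using h0
      · simp only [show ¬ n - (j - i) ≤ i by omega, if_false,
          show n - (j - i) + (j - i) = n by omega, hn]
      · intro k hk
        grind
      · intro k hk hkn
        grind
    · obtain rfl : j = n := by omega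
      grind
  refine ⟨n, f, h0, hn, hC, hne, fun i j hij hj => ⟨fun ha => ?_, ?_⟩⟩
  · by_contra hji
    refine hmin (n - (j - i - 1)) (by omega)
      ⟨fun k => if k ≤ i then f k else f (k + (j - i - 1)), ?_, ?_, ?_, ?_⟩
    · simpa using h0
    · simp only [show ¬ n - (j - i - 1) ≤ i by omega, if_false,
        show n - (j - i - 1) + (j - i - 1) = n by omega, hn]
    · intro k hk
      clear hne hpath hmin
      rcases lt_trichotomy k i with hki | rfl | hki
      · simpa [hki.le, Nat.succ_le_of_lt hki] using hadj k (by omega)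
      · simpa [show k + 1 + (j - k - 1) = j by omega] using ha
      · simpa [show ¬ k ≤ i by omega, show ¬ k + 1 ≤ i by omega,
          show k + 1 + (j - i - 1) = k + (j - i - 1) + 1 by omega]
          using hadj (k + (j - i - 1)) (by omega)
    · intro k hk hkn
      clear hne hpath hmin
      grind
  · rintro rfl
    exact hadj i (by omega)

theorem Relation.ReflTransGen.exists_seq {α : Type*} {r : α → α → Prop} {a b : α}
    (h : Relation.ReflTransGen r a b) :
    ∃ (n : ℕ) (f : ℕ → α), f 0 = a ∧ f n = b ∧ ∀ i < n, r (f i) (f (i + 1)) := by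
  induction h with
  | refl => exact ⟨0, fun _ => a, rfl, rfl, by simp⟩
  | @tail b c _ hbc ih =>
    obtain ⟨n, f, h0, hn, hr⟩ := ih
    refine ⟨n + 1, fun k => if k ≤ n then f k else c, by simpa using h0, by simp, ?_⟩
    intro i hi
    grind

/-- In a chordal graph, two neighbours of `v` joined by a path avoiding the closed
neighbourhood of `v` are adjacent. -/
theorem Chordal.adj_of_path {V : Type*} {G : SimpleGraph V} (hc : Chordal G) {C : Set V}
    {v x y : V} (hxy : x ≠ y) (hvx : G.Adj v x) (hvy : G.Adj v y) (hvC : v ∉ C)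
    (hC : ∀ c ∈ C, ¬ G.Adj v c)
    (hpath : ∃ (n : ℕ) (f : ℕ → V), f 0 = x ∧ f n = y ∧ (∀ i < n, G.Adj (f i) (f (i + 1))) ∧
      ∀ i, 0 < i → i < n → f i ∈ C) : G.Adj x y := by
  by_contra hna
  obtain ⟨n, f, h0, hn, hfC, hne, hadj⟩ := exists_induced_path G hxy
    (fun h => hC y h hvy) hpath
  have hn2 : 2 ≤ n := by
    rcases n with _ | _ | n
    · exact absurd (h0.symm.trans hn) hxy
    · exact absurd ((hadj 0 1 (by omega) le_rfl).2 rfl) (by rwa [h0, hn])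
    · omega
  have hfv : ∀ i ≤ n, f i ≠ v := by
    intro i hi hfi
    have := hvx.ne
    have := hvy.ne
    grind
  have hva : ∀ i ≤ n, (G.Adj v (f i) ↔ i = 0 ∨ i = n) := by
    intro i hi
    grind
  have hadj' : ∀ i j, i ≤ n → j ≤ n → (G.Adj (f i) (f j) ↔ j = i + 1 ∨ i = j + 1) := by
    intro i j hi hj
    rcases lt_trichotomy i j with h | rfl | h
    · rw [hadj i j h hj]; omega
    · simp
    · rw [G.adj_comm, hadj j i h hi]; omega
  have hinj : Function.Injective fun i : Fin (n + 2) => if i.val ≤ n then f i else v := by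
    intro i j hij
    have := i.2
    have := j.2
    ext
    grind
  refine (hc.isEmpty_cycleGraph_embedding (n := n + 2) (by omega)).false
    ⟨⟨_, hinj⟩, fun {i j} => ?_⟩
  have hi := i.2
  have hj := j.2
  rw [SimpleGraph.cycleGraph_adj']
  simp only [Function.Embedding.coeFn_mk, Fin.sub_def]
  have hmod : ∀ a b : ℕ, a < n + 2 → b < n + 2 →
      ((n + 2 - b + a) % (n + 2) = 1 ↔ a = b + 1 ∨ (a = 0 ∧ b = n + 1)) := by
    intro a b ha hb
    rcases Nat.lt_or_ge a b with h | h
    · rw [Nat.mod_eq_of_lt (by omega)]; omega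
    · rw [show n + 2 - b + a = (a - b) + (n + 2) by omega, Nat.add_mod_right,
        Nat.mod_eq_of_lt (by omega)]; omega
  rw [hmod _ _ hi hj, hmod _ _ hj hi]
  by_cases h1 : i.val ≤ n <;> by_cases h2 : j.val ≤ n
  · simp only [h1, h2, if_true, hadj' _ _ h1 h2]; omega
  · simp only [h1, h2, if_true, if_false]
    rw [G.adj_comm, hva _ h1]; omega
  · simp only [h1, h2, if_true, if_false]
    rw [hva _ h2]; omega
  · simp only [h1, h2, if_false, SimpleGraph.irrefl, false_iff]; omega

/-- If every non-dominating vertex of `A` has a simplicial non-neighbour in `A`, then `A` has a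
simplicial vertex. -/
theorem exists_simplicial_of_forall_not_adj {V : Type*} {G : SimpleGraph V} {A : Finset V}
    (hA : A.Nonempty) (h : ∀ v ∈ A, (∃ u ∈ A, u ≠ v ∧ ¬ G.Adj v u) →
      ∃ w ∈ A, w ≠ v ∧ ¬ G.Adj v w ∧ G.IsClique {u | u ∈ A ∧ G.Adj w u}) :
    ∃ w ∈ A, G.IsClique {u | u ∈ A ∧ G.Adj w u} := by
  by_cases hv : ∃ v ∈ A, ∃ u ∈ A, u ≠ v ∧ ¬ G.Adj v u
  · obtain ⟨v, hvA, hu⟩ := hv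
    obtain ⟨w, hw, -, -, hcl⟩ := h v hvA hu
    exact ⟨w, hw, hcl⟩
  · push Not at hv
    obtain ⟨w, hw⟩ := hA
    exact ⟨w, hw, fun x hx y hy hxy => hv x hx.1 y hy.1 hxy.symm⟩

/-- Dirac: inside any finite set `A` of vertices of a chordal graph, every vertex `v` that is
not adjacent to all others has a non-neighbour that is simplicial in `A`. -/
theorem Chordal.exists_simplicial_not_adj {V : Type*} {G : SimpleGraph V} (hc : Chordal G)
    (A : Finset V) : ∀ v ∈ A, (∃ u ∈ A, u ≠ v ∧ ¬ G.Adj v u) →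
      ∃ w ∈ A, w ≠ v ∧ ¬ G.Adj v w ∧ G.IsClique {u | u ∈ A ∧ G.Adj w u} := by
  classical
  induction A using Finset.strongInduction with
  | H A ih =>
  rintro v hv ⟨c, hcA, hcv, hvc⟩
  let r : V → V → Prop := fun a b =>
    G.Adj a b ∧ (a ∈ A ∧ a ≠ v ∧ ¬ G.Adj v a) ∧ (b ∈ A ∧ b ≠ v ∧ ¬ G.Adj v b)
  have hr : Std.Symm r := ⟨fun a b h => ⟨h.1.symm, h.2.2, h.2.1⟩⟩
  let C := A.filter (Relation.ReflTransGen r c)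
  have hC : ∀ a ∈ C, a ∈ A ∧ a ≠ v ∧ ¬ G.Adj v a := by
    intro a ha
    rcases Relation.ReflTransGen.cases_tail (Finset.mem_filter.1 ha).2 with h | ⟨b, -, hb⟩
    · subst h; exact ⟨hcA, hcv, hvc⟩
    · exact hb.2.2
  have hcC : c ∈ C := Finset.mem_filter.2 ⟨hcA, .refl⟩
  have hCstep : ∀ a ∈ C, ∀ b ∈ A, G.Adj a b → b ∈ C ∨ G.Adj v b := by
    intro a ha b hb hab
    by_cases hvb : G.Adj v b
    · exact Or.inr hvb
    refine Or.inl (Finset.mem_filter.2 ⟨hb, (Finset.mem_filter.1 ha).2.tail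
      ⟨hab, hC a ha, hb, ?_, hvb⟩⟩)
    rintro rfl
    exact (hC a ha).2.2 hab.symm
  let S := A.filter fun s => G.Adj v s ∧ ∃ a ∈ C, G.Adj a s
  have hSmem : ∀ s, s ∈ S ↔ s ∈ A ∧ G.Adj v s ∧ ∃ a ∈ C, G.Adj a s := by simp [S]
  have hS : ∀ x ∈ S, ∀ y ∈ S, x ≠ y → G.Adj x y := by
    intro x hx y hy hxy
    obtain ⟨-, hvx, a, ha, hax⟩ := (hSmem x).1 hx
    obtain ⟨-, hvy, b, hb, hby⟩ := (hSmem y).1 hy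
    have hca := (Finset.mem_filter.1 ha).2
    have hcb := (Finset.mem_filter.1 hb).2
    obtain ⟨n, f, h0, hn, hf⟩ := ((symm hca).trans hcb).exists_seq
    have hfC : ∀ i ≤ n, f i ∈ C := by
      intro i
      induction i with
      | zero => intro _; rwa [h0]
      | succ i hi =>
        intro hin
        have hstep := hf i (by omega)
        exact Finset.mem_filter.2 ⟨hstep.2.2.1, (Finset.mem_filter.1 (hi (by omega))).2.tail hstep⟩
    refine hc.adj_of_path (C := (C : Set V)) hxy hvx hvy (fun h => (hC v h).2.1 rfl)
      (fun d hd => (hC d hd).2.2)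
      ⟨n + 2, fun k => if k = 0 then x else if k ≤ n + 1 then f (k - 1) else y, by simp, by simp,
        ?_, ?_⟩
    · intro i hi
      have := hax.symm
      have hf1 := fun i hi => (hf i hi).1
      rcases i with _ | i
      · simpa [h0] using this
      · rcases Nat.lt_or_ge i n with h | h
        · simpa [show i ≤ n by omega, show i + 1 ≤ n by omega] using hf1 i h
        · obtain rfl : i = n := by omega
          simpa [hn] using hby
    · intro i hi hin
      simp only [show i ≠ 0 by omega, show i ≤ n + 1 by omega, if_true, if_false]
      exact hfC _ (by omega)
  suffices h : ∃ w ∈ C, G.IsClique {u | u ∈ C ∪ S ∧ G.Adj w u} by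
    obtain ⟨w, hw, hcl⟩ := h
    obtain ⟨hwA, hwv, hvw⟩ := hC w hw
    refine ⟨w, hwA, hwv, hvw, hcl.subset ?_⟩
    rintro u ⟨huA, hwu⟩
    refine ⟨?_, hwu⟩
    rcases hCstep w hw u huA hwu with h | h
    · exact Finset.mem_union_left _ h
    · exact Finset.mem_union_right _ ((hSmem u).2 ⟨huA, h, w, hw, hwu⟩)
  have hvCS : v ∉ C ∪ S := by
    simp only [Finset.mem_union, not_or]
    exact ⟨fun h => (hC v h).2.1 rfl, fun h => G.irrefl ((hSmem v).1 h).2.1⟩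
  have hCS : C ∪ S ⊂ A := (Finset.ssubset_iff_of_subset
    (Finset.union_subset (Finset.filter_subset _ _) (Finset.filter_subset _ _))).2 ⟨v, hv, hvCS⟩
  by_cases hdom : ∀ s ∈ S, ∀ u ∈ C ∪ S, u ≠ s → G.Adj s u
  · obtain ⟨w, hw, hcl⟩ := exists_simplicial_of_forall_not_adj ⟨c, hcC⟩
      (ih C (Finset.subset_union_left.trans_ssubset hCS))
    refine ⟨w, hw, ?_⟩
    rintro x ⟨hx, hwx⟩ y ⟨hy, hwy⟩ hxy
    rcases Finset.mem_union.1 hx with hxC | hxS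
    · rcases Finset.mem_union.1 hy with hyC | hyS
      · exact hcl ⟨hxC, hwx⟩ ⟨hyC, hwy⟩ hxy
      · exact (hdom y hyS x hx hxy).symm
    · exact hdom x hxS y hy hxy.symm
  · push Not at hdom
    obtain ⟨s, hs, u, hu, hus, hsu⟩ := hdom
    obtain ⟨w, hw, hws, hsw, h⟩ := ih _ hCS s (Finset.mem_union_right _ hs) ⟨u, hu, hus, hsu⟩
    refine ⟨w, (Finset.mem_union.1 hw).resolve_right fun hwS => hsw (hS s hs w hwS hws.symm), h⟩

/-- A nonempty finite chordal graph has a simplicial vertex. -/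
theorem Chordal.exists_isClique_neighborSet {V : Type*} [Finite V] [Nonempty V]
    {G : SimpleGraph V} (hc : Chordal G) : ∃ v, G.IsClique (G.neighborSet v) := by
  have := Fintype.ofFinite V
  obtain ⟨w, -, hw⟩ := exists_simplicial_of_forall_not_adj Finset.univ_nonempty
    (hc.exists_simplicial_not_adj Finset.univ)
  exact ⟨w, fun x hx y hy hxy => hw ⟨Finset.mem_univ x, hx⟩ ⟨Finset.mem_univ y, hy⟩ hxy⟩

/-- If `G` is a triangulated minimal S-imperfect graph, then `θ_S(G) = α_S(G) + 1`. -/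
theorem minSImperfect_thetaS_eq_alphaS_add_one {V : Type*} [Fintype V]
    (G : SimpleGraph V) (hc : Chordal G) (h : MinSImperfect G) :
    thetaS G = alphaS G + 1 := by
  have hV : Nonempty V := by
    by_contra hV
    rw [not_nonempty_iff] at hV
    have h0 : thetaS G ≤ 0 :=
      SimpleGraph.DominatingSet.thetaS_le_card (D := ∅) fun v => isEmptyElim v
    have := alphaS_le_thetaS G
    exact h.1 (by omega)
  obtain ⟨v, hv⟩ := hc.exists_isClique_neighborSet
  let φ : (G.induce {v}ᶜ).induce Set.univ ↪g G :=
    (SimpleGraph.Embedding.induce _).comp (SimpleGraph.Embedding.induce _)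
  have hφ : ∀ w, w ≠ v → w ∈ Set.range φ := fun w hw => ⟨⟨⟨w, hw⟩, trivial⟩, rfl⟩
  have h1 := thetaS_le_thetaS_add_one φ hφ
  have h2 := alphaS_le_alphaS_of_isClique_neighborSet φ hφ hv
  have h3 := h.2 v Set.univ
  have h4 := alphaS_le_thetaS G
  have h5 := h.1
  omega
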